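/- Fix integers r ≥ 1 and k ≥ 2. Then the group T_{r,k}, acting on S_r, is locally dense: for every nonempty open subset U of S_r and every point x ∈ U, the orbit of x under the subgroup G_U = { g ∈ T_{r,k} : the closure of { y : g(y) ≠ y } is contained in U } is dense in some nonempty open subset of U. -/

import Mathlib

open Filter Topology Set

/-- The right derivative of `f` at `x`. -/
noncomputable def rDeriv (f : ℝ → ℝ) (x : ℝ) : ℝ := derivWithin f (Set.Ici x) x

/-- The left derivative of `f` at `x`. -/
noncomputable def lDeriv (f : ℝ → ℝ) (x : ℝ) : ℝ := derivWithin f (Set.Iic x) x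

/-- `x` is a break point of `f`: the one-sided slopes at `x` differ. -/
def IsBreak (f : ℝ → ℝ) (x : ℝ) : Prop := rDeriv f x ≠ lDeriv f x

/-- The jump of `f` at `x` : the ratio of the right and left derivatives. -/
noncomputable def jumpRatio (f : ℝ → ℝ) (x : ℝ) : ℝ := rDeriv f x / lDeriv f x

/-- `f : ℝ → ℝ` is (the lift of) an orientation-preserving piecewise linear
homeomorphism of the circle `S_r = ℝ/rℤ` : it is strictly increasing, commutes with
the translation by `r`, and is affine on each interval of a finite subdivision
`0 = a 0 < a 1 < ⋯ < a k = r`. -/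
def IsPLplus (r : ℝ) (f : ℝ → ℝ) : Prop :=
  StrictMono f ∧ Continuous f ∧ (∀ x, f (x + r) = f x + r) ∧
    ∃ (k : ℕ) (a : ℕ → ℝ), 1 ≤ k ∧ a 0 = 0 ∧ a k = r ∧
      (∀ i, i < k → a i < a (i + 1)) ∧
      (∀ i, i < k → ∃ lam c : ℝ, 0 < lam ∧
        ∀ x ∈ Set.Icc (a i) (a (i + 1)), f x = lam * x + c)

/-- `f : ℝ → ℝ` is (the lift of) an orientation-reversing piecewise linear
homeomorphism of the circle `S_r = ℝ/rℤ`. -/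
def IsPLminus (r : ℝ) (f : ℝ → ℝ) : Prop :=
  StrictAnti f ∧ Continuous f ∧ (∀ x, f (x + r) = f x - r) ∧
    ∃ (k : ℕ) (a : ℕ → ℝ), 1 ≤ k ∧ a 0 = 0 ∧ a k = r ∧
      (∀ i, i < k → a i < a (i + 1)) ∧
      (∀ i, i < k → ∃ lam c : ℝ, lam < 0 ∧
        ∀ x ∈ Set.Icc (a i) (a (i + 1)), f x = lam * x + c)

/-- `f` is (the lift of) a piecewise linear homeomorphism of the circle `S_r`,
orientation-preserving or orientation-reversing. -/
def IsPLany (r : ℝ) (f : ℝ → ℝ) : Prop := IsPLplus r f ∨ IsPLminus r f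

/-- All slopes of `f` lie in `Λ`. -/
def SlopesIn (L : Set ℝ) (f : ℝ → ℝ) : Prop := ∀ x : ℝ, rDeriv f x ∈ L

/-- `x` lies in `A` modulo `rℤ`. -/
def InModR (r : ℝ) (A : Set ℝ) (x : ℝ) : Prop := ∃ n : ℤ, x - n * r ∈ A

/-- All break points of `f` and their images lie in `A` (mod `rℤ`). -/
def BreaksIn (r : ℝ) (A : Set ℝ) (f : ℝ → ℝ) : Prop :=
  ∀ x : ℝ, IsBreak f x → InModR r A x ∧ InModR r A (f x)

/-- `ℤ[1/m]` as a subset of `ℝ`. -/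
def Zinv (m : ℕ) : Set ℝ := {a : ℝ | ∃ (p : ℤ) (k : ℕ), a = (p : ℝ) / (m : ℝ) ^ k}

/-- The set of integer powers of `m`, as a subset of `ℝ`. -/
def powersOf (m : ℕ) : Set ℝ := {y : ℝ | ∃ n : ℤ, y = (m : ℝ) ^ n}

/-- Membership in the Thompson group `T_{r,m}` (at the level of lifts):
slopes are integer powers of `m`, break points and their images lie in `ℤ[1/m]`. -/
def memT (r : ℝ) (m : ℕ) (f : ℝ → ℝ) : Prop :=
  IsPLplus r f ∧ SlopesIn (powersOf m) f ∧ BreaksIn r (Zinv m) f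

/-- The multiplicative subgroup of `ℝ` generated by the integers `n 0, …, n (p-1)`. -/
def LambdaSet (p : ℕ) (n : Fin p → ℕ) : Set ℝ :=
  {x : ℝ | ∃ g : Fin p → ℤ, x = ∏ i, (n i : ℝ) ^ (g i)}

/-- Membership in the Thompson–Stein group `T_{r,(n_1,…,n_p)}` (at the level of lifts):
slopes lie in `⟨n_1,…,n_p⟩`, break points and their images lie in `ℤ[1/m]`,
`m = lcm (n_i)`. -/
def memTS (r : ℝ) (p : ℕ) (n : Fin p → ℕ) (f : ℝ → ℝ) : Prop :=
  IsPLplus r f ∧ SlopesIn (LambdaSet p n) f ∧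
    BreaksIn r (Zinv (Finset.lcm Finset.univ n)) f

/-- `ρ` is (a representative of) the rotation number of the circle map with lift `f`:
`ρ = lim f̃ⁿ(0)/(r n)`. -/
def HasRotNum (r : ℝ) (f : ℝ → ℝ) (ρ : ℝ) : Prop :=
  Filter.Tendsto (fun nn : ℕ => f^[nn] 0 / (r * nn)) Filter.atTop (nhds ρ)

/-- `g` is a lift of the identity of the circle `ℝ/rℤ`, i.e. a translation by a
multiple of `r`. -/
def IsCircleId (r : ℝ) (g : ℝ → ℝ) : Prop := ∃ n : ℤ, ∀ x : ℝ, g x = x + n * r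

/-- The permutation `e` of the circle `ℝ/rℤ` is an element of the Thompson group
`T_{r,m}`. -/
def InTcirc (r : ℝ) (m : ℕ) (e : Equiv.Perm (AddCircle r)) : Prop :=
  ∃ f : ℝ → ℝ, memT r m f ∧ ∀ x : ℝ, e (x : AddCircle r) = ((f x : ℝ) : AddCircle r)

/-- The permutation `e` of the circle `ℝ/rℤ` is an element of the Thompson–Stein
group `T_{r,(n_1,…,n_p)}`. -/
def InTScirc (r : ℝ) (p : ℕ) (n : Fin p → ℕ) (e : Equiv.Perm (AddCircle r)) : Prop :=
  ∃ f : ℝ → ℝ, memTS r p n f ∧ ∀ x : ℝ, e (x : AddCircle r) = ((f x : ℝ) : AddCircle r)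

/-! ### The ring `ℤ[1/m]` -/

theorem zinv_add {m : ℕ} (hm : 2 ≤ m) {x y : ℝ} (hx : x ∈ Zinv m) (hy : y ∈ Zinv m) :
    x + y ∈ Zinv m := by
  obtain ⟨p, i, rfl⟩ := hx
  obtain ⟨q, j, rfl⟩ := hy
  have h0 : (m : ℝ) ≠ 0 := by positivity
  refine ⟨p * m ^ j + q * m ^ i, i + j, ?_⟩
  push_cast
  rw [pow_add]
  field_simp

theorem zinv_int_mul {m : ℕ} (n : ℤ) {x : ℝ} (hx : x ∈ Zinv m) : n * x ∈ Zinv m := by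
  obtain ⟨p, i, rfl⟩ := hx
  exact ⟨n * p, i, by push_cast; ring⟩

theorem zinv_sub {m : ℕ} (hm : 2 ≤ m) {x y : ℝ} (hx : x ∈ Zinv m) (hy : y ∈ Zinv m) :
    x - y ∈ Zinv m := by
  have := zinv_add hm hx (zinv_int_mul (-1) hy)
  push_cast at this
  convert this using 1
  ring

theorem dense_zinv {m : ℕ} (hm : 2 ≤ m) : Dense (Zinv m) := by
  refine dense_of_exists_between fun x y hxy => ?_
  have hm1 : (1 : ℝ) < m := by exact_mod_cast hm
  obtain ⟨n, hn⟩ := pow_unbounded_of_one_lt (1 / (y - x)) hm1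
  have hpos : (0 : ℝ) < (m : ℝ) ^ n := by positivity
  have hyx : 0 < y - x := sub_pos.2 hxy
  rw [div_lt_iff₀ hyx] at hn
  refine ⟨((⌊x * (m : ℝ) ^ n⌋ + 1 : ℤ) : ℝ) / (m : ℝ) ^ n, ⟨_, n, rfl⟩, ?_, ?_⟩
  · rw [lt_div_iff₀ hpos]
    push_cast
    exact Int.lt_floor_add_one _
  · rw [div_lt_iff₀ hpos]
    push_cast
    have := Int.floor_le (x * (m : ℝ) ^ n)
    nlinarith

/-! ### One-sided slopes of piecewise affine functions -/

/-- `f` is affine of slope `l` on some interval `[x, x + ε]`. -/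
def RSlope (f : ℝ → ℝ) (x l : ℝ) : Prop :=
  ∃ ε > 0, ∀ y ∈ Icc x (x + ε), f y = f x + l * (y - x)

/-- `f` is affine of slope `l` on some interval `[x - ε, x]`. -/
def LSlope (f : ℝ → ℝ) (x l : ℝ) : Prop :=
  ∃ ε > 0, ∀ y ∈ Icc (x - ε) x, f y = f x + l * (y - x)

theorem RSlope.hasDerivWithinAt {f : ℝ → ℝ} {x l : ℝ} (h : RSlope f x l) :
    HasDerivWithinAt f l (Ici x) x := by
  obtain ⟨ε, hε, h⟩ := h
  have h1 : HasDerivWithinAt (fun y => f x + l * (y - x)) l (Ici x) x := by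
    simpa using ((((hasDerivAt_id x).sub_const x).const_mul l).const_add (f x)).hasDerivWithinAt
  refine h1.congr_of_eventuallyEq ?_ (by simp)
  filter_upwards [Icc_mem_nhdsGE (show x < x + ε by linarith)] with y hy using h y hy

theorem LSlope.hasDerivWithinAt {f : ℝ → ℝ} {x l : ℝ} (h : LSlope f x l) :
    HasDerivWithinAt f l (Iic x) x := by
  obtain ⟨ε, hε, h⟩ := h
  have h1 : HasDerivWithinAt (fun y => f x + l * (y - x)) l (Iic x) x := by
    simpa using ((((hasDerivAt_id x).sub_const x).const_mul l).const_add (f x)).hasDerivWithinAt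
  refine h1.congr_of_eventuallyEq ?_ (by simp)
  filter_upwards [Icc_mem_nhdsLE (show x - ε < x by linarith)] with y hy using h y hy

theorem RSlope.rDeriv_eq {f : ℝ → ℝ} {x l : ℝ} (h : RSlope f x l) : rDeriv f x = l :=
  h.hasDerivWithinAt.derivWithin (uniqueDiffOn_Ici x x self_mem_Ici)

theorem LSlope.lDeriv_eq {f : ℝ → ℝ} {x l : ℝ} (h : LSlope f x l) : lDeriv f x = l :=
  h.hasDerivWithinAt.derivWithin (uniqueDiffOn_Iic x x self_mem_Iic)

theorem RSlope.of_affineOn {f : ℝ → ℝ} {u v l c x : ℝ} (h : ∀ y ∈ Icc u v, f y = l * y + c)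
    (hu : u ≤ x) (hv : x < v) : RSlope f x l := by
  refine ⟨v - x, by linarith, fun y hy => ?_⟩
  rw [h y ⟨by linarith [hy.1], by linarith [hy.2]⟩, h x ⟨hu, hv.le⟩]
  ring

theorem LSlope.of_affineOn {f : ℝ → ℝ} {u v l c x : ℝ} (h : ∀ y ∈ Icc u v, f y = l * y + c)
    (hu : u < x) (hv : x ≤ v) : LSlope f x l := by
  refine ⟨x - u, by linarith, fun y hy => ?_⟩
  rw [h y ⟨by linarith [hy.1], by linarith [hy.2]⟩, h x ⟨hu.le, hv⟩]
  ring

theorem map_add_int_mul {f : ℝ → ℝ} {r : ℝ} (hf : ∀ x, f (x + r) = f x + r) (n : ℤ) (x : ℝ) :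
    f (x + n * r) = f x + n * r := by
  have : Function.Periodic (fun y => f y - y) r := fun y => by simp only [hf]; ring
  have := this.int_mul n x
  linarith

theorem RSlope.of_sub_int_mul {f : ℝ → ℝ} {r x l : ℝ} (hf : ∀ x, f (x + r) = f x + r) (n : ℤ)
    (h : RSlope f (x - n * r) l) : RSlope f x l := by
  obtain ⟨ε, hε, h⟩ := h
  refine ⟨ε, hε, fun y hy => ?_⟩
  have h1 := h (y - n * r) ⟨by linarith [hy.1], by linarith [hy.2]⟩
  have h2 := map_add_int_mul hf n (y - n * r)
  have h3 := map_add_int_mul hf n (x - n * r)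
  rw [sub_add_cancel] at h2 h3
  linear_combination h2 - h3 + h1

theorem LSlope.of_sub_int_mul {f : ℝ → ℝ} {r x l : ℝ} (hf : ∀ x, f (x + r) = f x + r) (n : ℤ)
    (h : LSlope f (x - n * r) l) : LSlope f x l := by
  obtain ⟨ε, hε, h⟩ := h
  refine ⟨ε, hε, fun y hy => ?_⟩
  have h1 := h (y - n * r) ⟨by linarith [hy.1], by linarith [hy.2]⟩
  have h2 := map_add_int_mul hf n (y - n * r)
  have h3 := map_add_int_mul hf n (x - n * r)
  rw [sub_add_cancel] at h2 h3
  linear_combination h2 - h3 + h1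

/-- `[p, q]` has a finite subdivision on whose intervals `f` is affine and increasing. -/
def HasSubdivision (f : ℝ → ℝ) (p q : ℝ) : Prop :=
  ∃ (k : ℕ) (a : ℕ → ℝ), a 0 = p ∧ a k = q ∧ (∀ i, i < k → a i < a (i + 1)) ∧
    (∀ i, i < k → ∃ lam c : ℝ, 0 < lam ∧ ∀ x ∈ Icc (a i) (a (i + 1)), f x = lam * x + c)

theorem HasSubdivision.extend {f : ℝ → ℝ} {p q q' l c : ℝ} (h : HasSubdivision f p q)
    (hq : q < q') (hl : 0 < l) (hf : ∀ x ∈ Icc q q', f x = l * x + c) :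
    HasSubdivision f p q' := by
  obtain ⟨k, a, h0, hk, hlt, haff⟩ := h
  refine ⟨k + 1, fun i => if i ≤ k then a i else q', by simpa using h0, by simp,
    fun i hi => ?_, fun i hi => ?_⟩
  · rcases (Nat.lt_succ_iff.1 hi).lt_or_eq with h | rfl
    · simpa [h.le, Nat.succ_le_of_lt h] using hlt i h
    · simpa [hk] using hq
  · rcases (Nat.lt_succ_iff.1 hi).lt_or_eq with h | rfl
    · simpa [h.le, Nat.succ_le_of_lt h] using haff i h
    · exact ⟨l, c, hl, by simpa [hk] using hf⟩

theorem hasSubdivision_of_slopes {f : ℝ → ℝ} (hR : ∀ x, ∃ l > 0, RSlope f x l)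
    (hL : ∀ x, ∃ l > 0, LSlope f x l) {p q : ℝ} (hpq : p ≤ q) : HasSubdivision f p q := by
  set S : Set ℝ := {t | t ∈ Icc p q ∧ HasSubdivision f p t}
  have hpS : p ∈ S := ⟨⟨le_rfl, hpq⟩, 0, fun _ => p, rfl, rfl, by simp, by simp⟩
  have hbdd : BddAbove S := ⟨q, fun t ht => ht.1.2⟩
  set t := sSup S with ht
  have hpt : p ≤ t := le_csSup hbdd hpS
  have htq : t ≤ q := csSup_le ⟨p, hpS⟩ fun t ht => ht.1.2
  have htS : HasSubdivision f p t := by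
    obtain ⟨l, hl, ε, hε, h⟩ := hL t
    obtain ⟨u, hu, hut⟩ := exists_lt_of_lt_csSup ⟨p, hpS⟩ (show t - ε < sSup S by linarith)
    rcases (le_csSup hbdd hu).lt_or_eq with hlt | heq
    · refine hu.2.extend (l := l) (c := f t - l * t) hlt hl fun y hy => ?_
      rw [h y ⟨by linarith [hy.1], hy.2⟩]
      ring
    · rw [ht, ← heq]
      exact hu.2
  rcases htq.lt_or_eq with hlt | heq
  · exfalso
    obtain ⟨l, hl, ε, hε, h⟩ := hR t
    have htv : t < min q (t + ε) := lt_min hlt (by linarith)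
    have : min q (t + ε) ∈ S := by
      refine ⟨⟨by linarith, min_le_left _ _⟩,
        htS.extend (l := l) (c := f t - l * t) htv hl fun y hy => ?_⟩
      rw [h y ⟨hy.1, hy.2.trans (min_le_right _ _)⟩]
      ring
    exact absurd (le_csSup hbdd this) (not_le.2 htv)
  · rwa [← heq]

theorem HasSubdivision.map_lt {f : ℝ → ℝ} {p q : ℝ} (h : HasSubdivision f p q) (hpq : p < q) :
    f p < f q := by
  obtain ⟨k, a, rfl, rfl, hlt, haff⟩ := h
  have hstep : ∀ i, i < k → f (a i) < f (a (i + 1)) := fun i hi => by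
    obtain ⟨l, c, hl, h⟩ := haff i hi
    rw [h _ (left_mem_Icc.2 (hlt i hi).le), h _ (right_mem_Icc.2 (hlt i hi).le)]
    have := mul_lt_mul_of_pos_left (hlt i hi) hl
    linarith
  have key : ∀ i, i < k → f (a 0) < f (a (i + 1)) := by
    intro i
    induction i with
    | zero => exact hstep 0
    | succ i ih => exact fun hi => (ih (by omega)).trans (hstep _ hi)
  cases k with
  | zero => exact absurd hpq (lt_irrefl _)
  | succ k => exact key k (Nat.lt_succ_self k)

/-- A degree one map of `ℝ` whose germs are those of elements of `T_{r,m}` is a lift of an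
element of `T_{r,m}`. -/
theorem memT_of_slopes {r : ℝ} (hr : 0 < r) {m : ℕ} (hm : 2 ≤ m) {f : ℝ → ℝ}
    (hf : ∀ x, f (x + r) = f x + r)
    (h : ∀ x, ∃ l ∈ powersOf m, ∃ l' ∈ powersOf m, RSlope f x l ∧ LSlope f x l' ∧
      (l = l' ∨ InModR r (Zinv m) x ∧ InModR r (Zinv m) (f x))) : memT r m f := by
  have hpos : ∀ l ∈ powersOf m, 0 < l := by
    rintro _ ⟨n, rfl⟩
    have : (0 : ℝ) < m := by positivity
    positivity
  have hR : ∀ x, ∃ l > 0, RSlope f x l := fun x => by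
    obtain ⟨l, hl, l', hl', h1, h2, -⟩ := h x
    exact ⟨l, hpos l hl, h1⟩
  have hL : ∀ x, ∃ l > 0, LSlope f x l := fun x => by
    obtain ⟨l, hl, l', hl', h1, h2, -⟩ := h x
    exact ⟨l', hpos l' hl', h2⟩
  refine ⟨⟨fun p q hpq => (hasSubdivision_of_slopes hR hL hpq.le).map_lt hpq, ?_, hf, ?_⟩, ?_, ?_⟩
  · rw [continuous_iff_continuousAt]
    intro x
    obtain ⟨l, -, l', -, h1, h2, -⟩ := h x
    exact continuousAt_iff_continuous_left_right.2
      ⟨h2.hasDerivWithinAt.continuousWithinAt, h1.hasDerivWithinAt.continuousWithinAt⟩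
  · obtain ⟨k, a, h0, hk, hlt, haff⟩ := hasSubdivision_of_slopes hR hL hr.le
    refine ⟨k, a, Nat.one_le_iff_ne_zero.2 ?_, h0, hk, hlt, haff⟩
    rintro rfl
    linarith
  · intro x
    obtain ⟨l, hl, l', -, h1, -⟩ := h x
    rwa [h1.rDeriv_eq]
  · intro x hx
    obtain ⟨l, -, l', -, h1, h2, h3⟩ := h x
    rcases h3 with rfl | h3
    · exact absurd (h1.rDeriv_eq.trans h2.lDeriv_eq.symm) hx
    · exact h3

/-! ### From lifts to circle permutations -/

theorem exists_perm_of_lift {r : ℝ} (hr : 0 < r) {f : ℝ → ℝ} (hmono : StrictMono f)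
    (hcont : Continuous f) (hf : ∀ x, f (x + r) = f x + r) :
    ∃ e : Equiv.Perm (AddCircle r), ∀ x : ℝ, e (x : AddCircle r) = (f x : AddCircle r) := by
  have hper : Function.Periodic (fun x => (f x : AddCircle r)) r := fun x => by
    simp [hf]
  have hlift : ∀ x : ℝ, hper.lift (x : AddCircle r) = (f x : AddCircle r) := fun x =>
    hper.lift_coe x
  have hbij : Function.Bijective (hper.lift : AddCircle r → AddCircle r) := by
    constructor
    · intro y z
      induction y using QuotientAddGroup.induction_on with | H y
      induction z using QuotientAddGroup.induction_on with | H z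
      intro hyz
      rw [hlift, hlift, ← sub_eq_zero, ← AddCircle.coe_sub, AddCircle.coe_eq_zero_iff] at hyz
      obtain ⟨n, hn⟩ := hyz
      rw [zsmul_eq_mul] at hn
      have : f y = f (z + n * r) := by
        rw [map_add_int_mul hf]
        linarith
      rw [hmono.injective this, ← zsmul_eq_mul]
      simp
    · intro y
      induction y using QuotientAddGroup.induction_on with | H y
      obtain ⟨n, hn⟩ := Archimedean.arch |y - f 0| hr
      rw [nsmul_eq_mul] at hn
      have hn' := abs_le.1 hn
      have h1 := map_add_int_mul hf n 0
      have h2 := map_add_int_mul hf (-n) 0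
      push_cast at h1 h2
      obtain ⟨x, hx⟩ := mem_range_of_exists_le_of_exists_ge hcont
        (⟨_, h2.trans_le (by linarith)⟩ : ∃ a, f a ≤ y)
        (⟨_, le_of_le_of_eq (by linarith) h1.symm⟩ : ∃ b, y ≤ f b)
      exact ⟨x, by rw [hlift, hx]⟩
  exact ⟨Equiv.ofBijective _ hbij, hlift⟩

/-! ### Bump maps -/

/-- The map equal to the identity outside `[a, b]`, with slopes `m`, `1`, `1 / m` on `[a, a + s]`,
`[a + s, b - m * s]`, `[b - m * s, b]`. -/
noncomputable def bumpMap (m : ℕ) (a b s y : ℝ) : ℝ :=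
  if y ≤ a then y else if y ≤ a + s then m * y + (a - m * a)
  else if y ≤ b - m * s then y + (m - 1) * s else if y ≤ b then (m : ℝ)⁻¹ * y + (b - (m : ℝ)⁻¹ * b)
  else y

/-- The degree one map agreeing with `bumpMap m a b s` on `[c, c + r]`. -/
noncomputable def periodicBump (r c : ℝ) (m : ℕ) (a b s y : ℝ) : ℝ :=
  bumpMap m a b s (y - ⌊(y - c) / r⌋ * r) + ⌊(y - c) / r⌋ * r

theorem periodicBump_add {r : ℝ} (hr : 0 < r) (c : ℝ) (m : ℕ) (a b s y : ℝ) :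
    periodicBump r c m a b s (y + r) = periodicBump r c m a b s y + r := by
  have : ⌊(y + r - c) / r⌋ = ⌊(y - c) / r⌋ + 1 := by
    rw [← Int.floor_add_one]
    congr 1
    field_simp
    ring
  simp only [periodicBump, this]
  push_cast
  rw [show y + r - (↑⌊(y - c) / r⌋ + 1) * r = y - ↑⌊(y - c) / r⌋ * r by ring]
  ring

theorem periodicBump_eq {r : ℝ} (hr : 0 < r) {c a b s : ℝ} {m : ℕ} (hm : 2 ≤ m) (hs : 0 < s)
    (hca : c < a) (hbc : b < c + r) (hab : a + s ≤ b - m * s) {y : ℝ} (hy : y ∈ Icc c (c + r)) :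
    periodicBump r c m a b s y = bumpMap m a b s y := by
  have hms : 0 < m * s := by positivity
  have key : ∀ z, c ≤ z → z < c + r →
      periodicBump r c m a b s z = bumpMap m a b s z := fun z h1 h2 => by
    have : ⌊(z - c) / r⌋ = 0 := by
      rw [Int.floor_eq_zero_iff]
      exact ⟨div_nonneg (by linarith) hr.le, (div_lt_one hr).2 (by linarith)⟩
    simp [periodicBump, this]
  rcases hy.2.lt_or_eq with h | rfl
  · exact key y hy.1 h
  · rw [periodicBump_add hr, key c le_rfl (by linarith)]
    simp only [bumpMap]
    rw [if_pos hca.le, if_neg (by linarith), if_neg (by linarith), if_neg (by linarith),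
      if_neg (by linarith)]

section Pieces

variable {m : ℕ} {a b s y : ℝ}

theorem bumpMap_of_le (h : y ≤ a) : bumpMap m a b s y = y := if_pos h

theorem bumpMap_of_ge (hm : 2 ≤ m) (hs : 0 < s) (hab : a + s ≤ b - m * s) (h : b ≤ y) :
    bumpMap m a b s y = y := by
  have hms : 0 < m * s := by positivity
  simp only [bumpMap]
  rw [if_neg (by linarith), if_neg (by linarith), if_neg (by linarith)]
  split_ifs with h1
  · rw [le_antisymm h1 h]
    ring
  · rfl

theorem bumpMap_expand (h1 : a ≤ y) (h2 : y ≤ a + s) :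
    bumpMap m a b s y = m * y + (a - m * a) := by
  simp only [bumpMap]
  split_ifs with h
  · rw [le_antisymm h h1]
    ring
  · rfl

theorem bumpMap_translate (hs : 0 < s) (h1 : a + s ≤ y) (h2 : y ≤ b - m * s) :
    bumpMap m a b s y = y + (m - 1) * s := by
  simp only [bumpMap]
  rw [if_neg (by linarith)]
  split_ifs with h
  · rw [le_antisymm h h1]
    ring
  · rfl

theorem bumpMap_contract (hm : 2 ≤ m) (hs : 0 < s) (hab : a + s ≤ b - m * s)
    (h1 : b - m * s ≤ y) (h2 : y ≤ b) :
    bumpMap m a b s y = (m : ℝ)⁻¹ * y + (b - (m : ℝ)⁻¹ * b) := by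
  have h0 : (m : ℝ) ≠ 0 := by positivity
  rcases h1.lt_or_eq with h | rfl
  · simp only [bumpMap]
    rw [if_neg (by linarith), if_neg (by linarith), if_neg (by linarith), if_pos h2]
  · rw [bumpMap_translate hs hab le_rfl]
    field_simp
    ring

end Pieces

theorem memT_periodicBump {r : ℝ} (hr : 0 < r) {c a b s : ℝ} {m : ℕ} (hm : 2 ≤ m) (hs : 0 < s)
    (hca : c < a) (hbc : b < c + r) (hab : a + s < b - m * s)
    (ha : a ∈ Zinv m) (hb : b ∈ Zinv m) (hsz : s ∈ Zinv m) :
    memT r m (periodicBump r c m a b s) := by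
  set f := periodicBump r c m a b s
  have hf : ∀ x, f (x + r) = f x + r := periodicBump_add hr c m a b s
  have hms : 0 < m * s := by positivity
  have heq : ∀ y ∈ Icc c (c + r), f y = bumpMap m a b s y := fun y hy =>
    periodicBump_eq hr hm hs hca hbc hab.le hy
  have p1 : ∀ y ∈ Icc c a, f y = 1 * y + 0 := fun y hy => by
    rw [heq y ⟨hy.1, by linarith [hy.2]⟩, bumpMap_of_le hy.2]
    ring
  have p2 : ∀ y ∈ Icc a (a + s), f y = m * y + (a - m * a) := fun y hy => by
    rw [heq y ⟨by linarith [hy.1], by linarith [hy.2]⟩, bumpMap_expand hy.1 hy.2]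
  have p3 : ∀ y ∈ Icc (a + s) (b - m * s), f y = 1 * y + (m - 1) * s := fun y hy => by
    rw [heq y ⟨by linarith [hy.1], by linarith [hy.2]⟩, bumpMap_translate hs hy.1 hy.2]
    ring
  have p4 : ∀ y ∈ Icc (b - m * s) b, f y = (m : ℝ)⁻¹ * y + (b - (m : ℝ)⁻¹ * b) := fun y hy => by
    rw [heq y ⟨by linarith [hy.1], by linarith [hy.2]⟩,
      bumpMap_contract hm hs hab.le hy.1 hy.2]
  have p5 : ∀ y ∈ Icc b (c + r), f y = 1 * y + 0 := fun y hy => by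
    rw [heq y ⟨by linarith [hy.1], hy.2⟩, bumpMap_of_ge hm hs hab.le hy.1]
    ring
  have q1 : (1 : ℝ) ∈ powersOf m := ⟨0, by simp⟩
  have qm : (m : ℝ) ∈ powersOf m := ⟨1, by simp⟩
  have qi : (m : ℝ)⁻¹ ∈ powersOf m := ⟨-1, by simp⟩
  have hmsz : m * s ∈ Zinv m := by exact_mod_cast zinv_int_mul (m : ℤ) hsz
  have main : ∀ x, c ≤ x → x < c + r → ∃ l ∈ powersOf m, ∃ l' ∈ powersOf m,
      RSlope f x l ∧ LSlope f x l' ∧ (l = l' ∨ x ∈ Zinv m ∧ f x ∈ Zinv m) := by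
    intro x hcx hxr
    rcases hcx.eq_or_lt with rfl | hcx
    · refine ⟨1, q1, 1, q1, .of_affineOn p1 le_rfl hca, .of_sub_int_mul hf (-1) ?_, Or.inl rfl⟩
      refine .of_affineOn p5 ?_ ?_ <;> push_cast <;> linarith
    rcases lt_trichotomy x a with h | rfl | hax
    · exact ⟨1, q1, 1, q1, .of_affineOn p1 hcx.le h, .of_affineOn p1 hcx h.le, Or.inl rfl⟩
    · refine ⟨m, qm, 1, q1, .of_affineOn p2 le_rfl (by linarith), .of_affineOn p1 hcx le_rfl,
        Or.inr ⟨ha, ?_⟩⟩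
      rw [p1 x ⟨hca.le, le_rfl⟩]
      simpa using ha
    rcases lt_trichotomy x (a + s) with h | rfl | hax'
    · exact ⟨m, qm, m, qm, .of_affineOn p2 hax.le h, .of_affineOn p2 hax h.le, Or.inl rfl⟩
    · refine ⟨1, q1, m, qm, .of_affineOn p3 le_rfl hab, .of_affineOn p2 hax le_rfl,
        Or.inr ⟨zinv_add hm ha hsz, ?_⟩⟩
      rw [p3 _ ⟨le_rfl, hab.le⟩]
      convert zinv_add hm ha hmsz using 1
      ring
    rcases lt_trichotomy x (b - m * s) with h | rfl | hbx
    · exact ⟨1, q1, 1, q1, .of_affineOn p3 hax'.le h, .of_affineOn p3 hax' h.le, Or.inl rfl⟩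
    · refine ⟨(m : ℝ)⁻¹, qi, 1, q1, .of_affineOn p4 le_rfl (by linarith),
        .of_affineOn p3 hab le_rfl, Or.inr ⟨zinv_sub hm hb hmsz, ?_⟩⟩
      rw [p3 _ ⟨hab.le, le_rfl⟩]
      convert zinv_sub hm hb hsz using 1
      ring
    rcases lt_trichotomy x b with h | rfl | hbx'
    · exact ⟨_, qi, _, qi, .of_affineOn p4 hbx.le h, .of_affineOn p4 hbx h.le, Or.inl rfl⟩
    · refine ⟨1, q1, (m : ℝ)⁻¹, qi, .of_affineOn p5 le_rfl hbc,
        .of_affineOn p4 hbx le_rfl, Or.inr ⟨hb, ?_⟩⟩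
      rw [p5 x ⟨le_rfl, hbc.le⟩]
      simpa using hb
    · exact ⟨1, q1, 1, q1, .of_affineOn p5 hbx'.le hxr, .of_affineOn p5 hbx' hxr.le, Or.inl rfl⟩
  refine memT_of_slopes hr hm hf fun x => ?_
  set n := ⌊(x - c) / r⌋
  have hn1 : n * r ≤ x - c := (le_div_iff₀ hr).1 (Int.floor_le _)
  have hn2 : x - c < (n + 1) * r := (div_lt_iff₀ hr).1 (Int.lt_floor_add_one _)
  obtain ⟨l, hl, l', hl', h1, h2, h3⟩ := main (x - n * r) (by linarith) (by linarith)
  refine ⟨l, hl, l', hl', h1.of_sub_int_mul hf n, h2.of_sub_int_mul hf n,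
    h3.imp_right fun h => ⟨⟨n, h.1⟩, n, ?_⟩⟩
  have := map_add_int_mul hf n (x - n * r)
  rw [sub_add_cancel] at this
  rw [this, add_sub_cancel_right]
  exact h.2

/-- Inside a proper arc with endpoints in `ℤ[1/m]`, the elements of `T_{r,m}` supported in the arc
can translate a point by `(m - 1) * s` for any small enough `s > 0` in `ℤ[1/m]`. -/
theorem exists_translating_perm {r : ℝ} (hr : 0 < r) {a b s x : ℝ} {m : ℕ} (hm : 2 ≤ m)
    (hs : 0 < s) (hba : b < a + r) (hax : a + s < x) (hxb : x ≤ b - m * s)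
    (ha : a ∈ Zinv m) (hb : b ∈ Zinv m) (hsz : s ∈ Zinv m) :
    ∃ e : Equiv.Perm (AddCircle r), InTcirc r m e ∧
      closure {z | e z ≠ z} ⊆ ((↑) : ℝ → AddCircle r) '' Icc a b ∧
      e (x : AddCircle r) = ((x + (m - 1) * s : ℝ) : AddCircle r) := by
  have hms : 0 < m * s := by positivity
  obtain ⟨c, hc1, hc2⟩ := exists_between (show b - r < a by linarith)
  have hbc : b < c + r := by linarith
  have hab : a + s < b - m * s := by linarith
  have hT := memT_periodicBump hr hm hs hc2 hbc hab ha hb hsz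
  obtain ⟨e, he⟩ := exists_perm_of_lift hr hT.1.1 hT.1.2.1 hT.1.2.2.1
  have heq : ∀ y ∈ Icc c (c + r), periodicBump r c m a b s y = bumpMap m a b s y := fun y hy =>
    periodicBump_eq hr hm hs hc2 hbc hab.le hy
  refine ⟨e, ⟨_, hT, he⟩, closure_minimal ?_ ?_, ?_⟩
  · intro z hz
    have : Fact (0 < r) := ⟨hr⟩
    obtain ⟨y, hy, rfl⟩ : z ∈ ((↑) : ℝ → AddCircle r) '' Ico c (c + r) := by
      rw [AddCircle.coe_image_Ico_eq]
      trivial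
    refine ⟨y, ?_, rfl⟩
    by_contra hn
    refine hz ?_
    rw [he, heq y (Ico_subset_Icc_self hy)]
    rcases not_and_or.1 hn with h | h
    · rw [bumpMap_of_le (not_le.1 h).le]
    · rw [bumpMap_of_ge hm hs hab.le (not_le.1 h).le]
  · have : Fact (0 < r) := ⟨hr⟩
    exact (isCompact_Icc.image (AddCircle.continuous_mk' r)).isClosed
  · rw [he, heq x ⟨by linarith, by linarith⟩, bumpMap_translate hs hax.le hxb]

/-- the group `T_{r,k}` acts locally densely on `S_r`: for every
nonempty open `U ⊆ S_r` and every `x ∈ U`, the orbit of `x` under the subgroup of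
elements of `T_{r,k}` supported in `U` is dense in some nonempty open subset of `U`. -/
theorem stmt17 (r k : ℕ) (hr : 1 ≤ r) (hk : 2 ≤ k)
    (U : Set (AddCircle (r : ℝ))) (hU : IsOpen U) (hUne : U.Nonempty)
    (x : AddCircle (r : ℝ)) (hx : x ∈ U) :
    ∃ V : Set (AddCircle (r : ℝ)), IsOpen V ∧ V.Nonempty ∧ V ⊆ U ∧
      V ⊆ closure {y : AddCircle (r : ℝ) |
        ∃ e : Equiv.Perm (AddCircle (r : ℝ)), InTcirc (r : ℝ) k e ∧
          closure {z : AddCircle (r : ℝ) | e z ≠ z} ⊆ U ∧ y = e x} := by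
  have hr0 : (0 : ℝ) < r := by exact_mod_cast hr
  have hk1 : (0 : ℝ) < (k : ℝ) - 1 := by
    have : (2 : ℝ) ≤ k := by exact_mod_cast hk
    linarith
  have hk0 : (0 : ℝ) < k := by linarith
  have hcont : Continuous ((↑) : ℝ → AddCircle (r : ℝ)) := AddCircle.continuous_mk' _
  induction x using QuotientAddGroup.induction_on with | H x
  obtain ⟨η, hη, hball⟩ := Metric.isOpen_iff.1 (hU.preimage hcont) x hx
  have hsub : ∀ y, x - η < y → y < x + η → (y : AddCircle (r : ℝ)) ∈ U := fun y h1 h2 =>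
    hball (by rw [Real.ball_eq_Ioo]; exact ⟨h1, h2⟩)
  obtain ⟨a, ha, ha1, ha2⟩ := (dense_zinv hk).exists_between
    (show x - min η (r / 2) < x by have := lt_min hη (half_pos hr0); linarith)
  obtain ⟨b, hb, hb1, hb2⟩ := (dense_zinv hk).exists_between
    (show x < x + min η (r / 2) by have := lt_min hη (half_pos hr0); linarith)
  have hm1 := min_le_left η ((r : ℝ) / 2)
  have hm2 := min_le_right η ((r : ℝ) / 2)
  have hIcc : ((↑) : ℝ → AddCircle (r : ℝ)) '' Icc a b ⊆ U := by
    rintro _ ⟨y, hy, rfl⟩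
    exact hsub y (by linarith [hy.1]) (by linarith [hy.2])
  set δ := min (x - a) ((b - x) / k)
  have hδ0 : 0 < δ := lt_min (by linarith) (div_pos (by linarith) hk0)
  have hδa : δ ≤ x - a := min_le_left _ _
  have hδb : k * δ ≤ b - x := by
    have : δ ≤ (b - x) / k := min_le_right _ _
    rw [le_div_iff₀ hk0] at this
    linarith
  refine ⟨((↑) : ℝ → AddCircle (r : ℝ)) '' Ioo x (x + (k - 1) * δ),
    QuotientAddGroup.isOpenMap_coe _ isOpen_Ioo, ?_, ?_, ?_⟩
  · exact (nonempty_Ioo.2 (by have := mul_pos hk1 hδ0; linarith)).image _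
  · refine (image_mono fun y hy => ?_).trans hIcc
    exact ⟨by linarith [hy.1], by linarith [hy.2]⟩
  · rintro _ ⟨w, hw, rfl⟩
    rw [mem_closure_iff]
    intro W hW hwW
    obtain ⟨s, hsW, hsz⟩ := (dense_zinv hk).inter_open_nonempty
      ((fun s : ℝ => ((x + (k - 1) * s : ℝ) : AddCircle (r : ℝ))) ⁻¹' W ∩ Ioo 0 δ)
      ((hW.preimage (hcont.comp (by fun_prop))).inter isOpen_Ioo) (by
        refine ⟨(w - x) / (k - 1), ?_, div_pos (by linarith [hw.1]) hk1, ?_⟩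
        · rw [mem_preimage, mul_div_cancel₀ _ hk1.ne', add_sub_cancel]
          exact hwW
        · rw [div_lt_iff₀ hk1]
          linarith [hw.2])
    have hks : (k : ℝ) * s < k * δ := mul_lt_mul_of_pos_left hsW.2.2 hk0
    obtain ⟨e, he, hsupp, hex⟩ := exists_translating_perm hr0 hk hsW.2.1
      (show b < a + r by linarith) (show a + s < x by linarith [hsW.2.2])
      (show x ≤ b - k * s by linarith) ha hb hsz
    exact ⟨_, hsW.1, e, he, hsupp.trans hIcc, hex.symm⟩
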